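/- Let G be the group of automorphisms of D generated by φ, and let D^G = {r ∈ D : ψ(r) = r for all ψ ∈ G} be the fixed ring. Then D^G equals the division subring R of D generated over k by h and g, and D^G is isomorphic to D = k_q(x,y) as a k-algebra (for the same q). -/

import Mathlib

/-- `D`, together with the distinguished nonzero elements `x`, `y` satisfying
`x * y = q • (y * x)`, is the `q`-division ring `k_q(x,y)`: the Ore division ring of fractions
of the quantum plane `k_q[x,y]`.  The quantum plane sits inside `D` as the `k`-subalgebra
generated by `x` and `y`; linear independence of the monomials `yⁱxʲ` says that this subalgebra
really is the quantum plane, and `exists_frac` says that `D` is its ring of (left) fractions. -/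
structure IsQDivisionRing (k : Type*) [Field k] (D : Type*) [DivisionRing D] [Algebra k D]
    (q : k) (x y : D) : Prop where
  x_ne_zero : x ≠ 0
  y_ne_zero : y ≠ 0
  rel : x * y = algebraMap k D q * (y * x)
  monomials_linearIndependent :
    LinearIndependent k fun p : ℕ × ℕ => y ^ p.1 * x ^ p.2
  exists_frac : ∀ d : D, ∃ s t : D, s ∈ Algebra.adjoin k ({x, y} : Set D) ∧
    t ∈ Algebra.adjoin k ({x, y} : Set D) ∧ t ≠ 0 ∧ d = t⁻¹ * s

/-- `MemDivisionClosure k s d` says that `d` lies in the division subring of `D`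
generated over `k` by the set `s`. -/
inductive MemDivisionClosure (k : Type*) [Field k] {D : Type*} [DivisionRing D] [Algebra k D]
    (s : Set D) : D → Prop
  | mem {a : D} : a ∈ s → MemDivisionClosure k s a
  | scalar (c : k) : MemDivisionClosure k s (algebraMap k D c)
  | add {a b : D} : MemDivisionClosure k s a → MemDivisionClosure k s b →
      MemDivisionClosure k s (a + b)
  | neg {a : D} : MemDivisionClosure k s a → MemDivisionClosure k s (-a)
  | mul {a b : D} : MemDivisionClosure k s a → MemDivisionClosure k s b →
      MemDivisionClosure k s (a * b)
  | inv {a : D} : MemDivisionClosure k s a → MemDivisionClosure k s a⁻¹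

theorem exists_algHom_of_subalgebra_prod {k D E : Type*} [Field k] [DivisionRing D] [Algebra k D]
    [DivisionRing E] [Algebra k E] (B : Subalgebra k (D × E))
    (hB : ∀ p ∈ B, p.1 = 0 ↔ p.2 = 0)
    (hfrac : ∀ d : D, ∃ s ∈ B, ∃ t ∈ B, t.1 ≠ 0 ∧ t.1 * d = s.1) :
    ∃ F : D →ₐ[k] E, ∀ p ∈ B, F p.1 = p.2 := by
  have inj : ∀ p ∈ B, ∀ r ∈ B, p.1 = r.1 → p.2 = r.2 := fun p hp r hr h =>
    sub_eq_zero.1 ((hB _ (sub_mem hp hr)).1 (sub_eq_zero.2 h))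
  have ore : ∀ p ∈ B, ∀ r ∈ B, p.1 ≠ 0 →
      ∃ e₁ ∈ B, ∃ e₂ ∈ B, e₂.1 ≠ 0 ∧ e₁.1 * p.1 = e₂.1 * r.1 ∧ e₁.2 * p.2 = e₂.2 * r.2 := by
    intro p hp r hr hp0
    obtain ⟨e₁, h₁, e₂, h₂, h0, h⟩ := hfrac (r.1 * p.1⁻¹)
    have h' : e₁.1 * p.1 = e₂.1 * r.1 := by
      rw [← h, mul_assoc, inv_mul_cancel_right₀ hp0]
    exact ⟨e₁, h₁, e₂, h₂, h0, h', inj _ (mul_mem h₁ hp) _ (mul_mem h₂ hr) h'⟩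
  choose s hs t ht ht0 hst using hfrac
  have ne2 : ∀ p ∈ B, p.1 ≠ 0 → p.2 ≠ 0 := fun p hp h => (hB p hp).not.1 h
  obtain ⟨f, tf⟩ : ∃ f : D → E, ∀ d, (t d).2 * f d = (s d).2 :=
    ⟨fun d => (t d).2⁻¹ * (s d).2, fun d => mul_inv_cancel_left₀ (ne2 _ (ht d) (ht0 d)) _⟩
  have key : ∀ d, ∀ p ∈ B, ∀ r ∈ B, p.1 ≠ 0 → p.1 * d = r.1 → p.2 * f d = r.2 := by
    intro d p hp r hr hp0 hpr
    obtain ⟨e₁, h₁, e₂, h₂, h0, h, h'⟩ := ore p hp (t d) (ht d) hp0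
    have he₁ : e₁.1 ≠ 0 := by
      intro h1
      rw [h1, zero_mul] at h
      exact mul_ne_zero h0 (ht0 d) h.symm
    have h3 : e₁.2 * r.2 = e₂.2 * (s d).2 := by
      refine inj _ (mul_mem h₁ hr) _ (mul_mem h₂ (hs d)) ?_
      change e₁.1 * r.1 = e₂.1 * (s d).1
      rw [← hpr, ← hst d, ← mul_assoc, h, mul_assoc]
    apply mul_left_cancel₀ (ne2 _ h₁ he₁)
    rw [h3, ← tf, ← mul_assoc, h', mul_assoc]
  have hB' : ∀ p ∈ B, f p.1 = p.2 := by
    intro p hp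
    have := key p.1 1 (one_mem B) p hp one_ne_zero (one_mul _)
    rwa [Prod.snd_one, one_mul] at this
  have hadd : ∀ d₁ d₂, f (d₁ + d₂) = f d₁ + f d₂ := by
    intro d₁ d₂
    obtain ⟨e₁, h₁, e₂, h₂, h0, h, h'⟩ := ore (t d₁) (ht d₁) (t d₂) (ht d₂) (ht0 d₁)
    have hp : e₂ * t d₂ ∈ B := mul_mem h₂ (ht d₂)
    have hp0 : (e₂ * t d₂).1 ≠ 0 := mul_ne_zero h0 (ht0 d₂)
    have := key (d₁ + d₂) (e₂ * t d₂) hp (e₁ * s d₁ + e₂ * s d₂)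
      (add_mem (mul_mem h₁ (hs _)) (mul_mem h₂ (hs _))) hp0 (by
        change e₂.1 * (t d₂).1 * (d₁ + d₂) = e₁.1 * (s d₁).1 + e₂.1 * (s d₂).1
        rw [mul_add, ← hst, ← hst, ← mul_assoc, ← mul_assoc, h])
    apply mul_left_cancel₀ (ne2 _ hp hp0)
    rw [this]
    change e₁.2 * (s d₁).2 + e₂.2 * (s d₂).2 = e₂.2 * (t d₂).2 * (f d₁ + f d₂)
    rw [mul_add, ← tf, ← tf, ← mul_assoc, ← mul_assoc, h']
  have hmul : ∀ d₁ d₂, f (d₁ * d₂) = f d₁ * f d₂ := by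
    intro d₁ d₂
    obtain ⟨e₁, h₁, e₂, h₂, h0, h, h'⟩ := ore (t d₂) (ht d₂) (s d₁) (hs d₁) (ht0 d₂)
    have hp : e₂ * t d₁ ∈ B := mul_mem h₂ (ht d₁)
    have hp0 : (e₂ * t d₁).1 ≠ 0 := mul_ne_zero h0 (ht0 d₁)
    have := key (d₁ * d₂) (e₂ * t d₁) hp (e₁ * s d₂) (mul_mem h₁ (hs _)) hp0 (by
        change e₂.1 * (t d₁).1 * (d₁ * d₂) = e₁.1 * (s d₂).1
        rw [← hst, ← mul_assoc e₁.1, h, ← hst d₁]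
        simp only [mul_assoc])
    apply mul_left_cancel₀ (ne2 _ hp hp0)
    rw [this]
    change e₁.2 * (s d₂).2 = e₂.2 * (t d₁).2 * (f d₁ * f d₂)
    rw [← tf, ← mul_assoc e₁.2, h', ← tf d₁]
    simp only [mul_assoc]
  have halg : ∀ c : k, f (algebraMap k D c) = algebraMap k E c := fun c =>
    hB' (algebraMap k (D × E) c) (B.algebraMap_mem c)
  refine ⟨{ toFun := f, map_one' := ?_, map_mul' := hmul, map_zero' := ?_, map_add' := hadd,
            commutes' := halg }, hB'⟩
  · simpa using halg 1
  · simpa using halg 0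

theorem pow_mul_pow_of_mul_eq_smul {k A : Type*} [CommSemiring k] [Semiring A] [Algebra k A]
    {q : k} {x y : A} (h : x * y = q • (y * x)) (j i : ℕ) :
    x ^ j * y ^ i = q ^ (j * i) • (y ^ i * x ^ j) := by
  have h1 : ∀ i : ℕ, x * y ^ i = q ^ i • (y ^ i * x) := by
    intro i
    induction i with
    | zero => simp
    | succ i ih =>
      rw [pow_succ, ← mul_assoc, ih, smul_mul_assoc, mul_assoc, h, mul_smul_comm, smul_smul,
        ← mul_assoc, pow_succ]
  induction j with
  | zero => simp
  | succ j ih =>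
    rw [pow_succ, mul_assoc, h1, mul_smul_comm, ← mul_assoc, ih, smul_mul_assoc, smul_smul,
      mul_assoc, ← pow_add, add_comm, Nat.succ_mul]

theorem adjoin_le_span_pow_mul_pow {k A : Type*} [CommSemiring k] [Semiring A] [Algebra k A]
    {q : k} {x y : A} (h : x * y = q • (y * x)) :
    (Algebra.adjoin k {x, y}).toSubmodule ≤
      Submodule.span k (Set.range fun p : ℕ × ℕ => y ^ p.1 * x ^ p.2) := by
  set W := Submodule.span k (Set.range fun p : ℕ × ℕ => y ^ p.1 * x ^ p.2)
  have hmem : ∀ i j : ℕ, y ^ i * x ^ j ∈ W := fun i j => Submodule.subset_span ⟨(i, j), rfl⟩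
  have hmul : W * W ≤ W := by
    rw [Submodule.span_mul_span, Submodule.span_le]
    rintro _ ⟨_, ⟨⟨i, j⟩, rfl⟩, _, ⟨⟨i', j'⟩, rfl⟩, rfl⟩
    have : y ^ i * x ^ j * (y ^ i' * x ^ j') = q ^ (j * i') • (y ^ (i + i') * x ^ (j + j')) := by
      rw [mul_assoc, ← mul_assoc (x ^ j), pow_mul_pow_of_mul_eq_smul h, smul_mul_assoc,
        mul_smul_comm, pow_add, pow_add]
      simp only [mul_assoc]
    simp only [SetLike.mem_coe, this]
    exact W.smul_mem _ (hmem _ _)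
  have h1 : (1 : A) ∈ W := by simpa using hmem 0 0
  intro d hd
  induction hd using Algebra.adjoin_induction with
  | mem d hd =>
    rcases hd with rfl | rfl
    · simpa using hmem 0 1
    · simpa using hmem 1 0
  | algebraMap c => rw [Algebra.algebraMap_eq_smul_one]; exact W.smul_mem _ h1
  | add _ _ _ _ h₁ h₂ => exact W.add_mem h₁ h₂
  | mul _ _ _ _ h₁ h₂ => exact hmul (Submodule.mul_mem_mul h₁ h₂)

theorem IsQDivisionRing.exists_algHom {k D E : Type*} [Field k] [DivisionRing D] [Algebra k D]
    [DivisionRing E] [Algebra k E] {q : k} {x y : D} (hD : IsQDivisionRing k D q x y) {u v : E}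
    (hrel : u * v = q • (v * u)) (hind : LinearIndependent k fun p : ℕ × ℕ => v ^ p.1 * u ^ p.2) :
    ∃ F : D →ₐ[k] E, F x = u ∧ F y = v := by
  have hxy : ((x, u) : D × E) * (y, v) = q • ((y, v) * (x, u)) := by
    ext
    · simpa [Algebra.smul_def] using hD.rel
    · simpa using hrel
  set B := Algebra.adjoin k ({(x, u), (y, v)} : Set (D × E)) with hBdef
  have hx : (x, u) ∈ B := Algebra.subset_adjoin (by simp)
  have hy : (y, v) ∈ B := Algebra.subset_adjoin (by simp)
  have hlift : ∀ d ∈ Algebra.adjoin k ({x, y} : Set D), ∃ p ∈ B, p.1 = d := by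
    have : (Algebra.adjoin k ({(x, u), (y, v)} : Set (D × E))).map (AlgHom.fst k D E) =
        Algebra.adjoin k {x, y} := by
      rw [AlgHom.map_adjoin, Set.image_pair]; rfl
    intro d hd
    rw [← this] at hd
    obtain ⟨p, hp, rfl⟩ := hd
    exact ⟨p, hp, rfl⟩
  obtain ⟨F, hF⟩ := exists_algHom_of_subalgebra_prod B (by
    intro p hp
    have := adjoin_le_span_pow_mul_pow hxy hp
    rw [Finsupp.mem_span_range_iff_exists_finsupp] at this
    obtain ⟨c, rfl⟩ := this
    have h1 : (c.sum fun i a => a • ((y, v) ^ i.1 * (x, u) ^ i.2 : D × E)).1 =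
        Finsupp.linearCombination k (fun p : ℕ × ℕ => y ^ p.1 * x ^ p.2) c := by
      simp [Finsupp.linearCombination_apply, Finsupp.sum, Prod.fst_sum]
    have h2 : (c.sum fun i a => a • ((y, v) ^ i.1 * (x, u) ^ i.2 : D × E)).2 =
        Finsupp.linearCombination k (fun p : ℕ × ℕ => v ^ p.1 * u ^ p.2) c := by
      simp [Finsupp.linearCombination_apply, Finsupp.sum, Prod.snd_sum]
    rw [h1, h2]
    constructor <;> intro h
    · rw [linearIndependent_iff.1 hD.monomials_linearIndependent c h, map_zero]
    · rw [linearIndependent_iff.1 hind c h, map_zero]) (by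
    intro d
    obtain ⟨s, t, hs, ht, ht0, rfl⟩ := hD.exists_frac d
    obtain ⟨s, hs', rfl⟩ := hlift s hs
    obtain ⟨t, ht', rfl⟩ := hlift t ht
    exact ⟨s, hs', t, ht', ht0, mul_inv_cancel_left₀ ht0 _⟩)
  exact ⟨F, hF _ hx, hF _ hy⟩

open Polynomial in
/-- `IsRationalIn k y f` says that `f` is a left fraction of polynomials in `y`. -/
def IsRationalIn (k : Type*) [Field k] {D : Type*} [DivisionRing D] [Algebra k D] (y f : D) :
    Prop :=
  ∃ p r : k[X], p ≠ 0 ∧ aeval y p * f = aeval y r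

namespace IsRationalIn

open Polynomial

variable {k D : Type*} [Field k] [DivisionRing D] [Algebra k D] {y f f' : D}

theorem aeval_mul_aeval_comm (y : D) (p r : k[X]) :
    aeval y p * aeval y r = aeval y r * aeval y p := by
  rw [← map_mul, mul_comm, map_mul]

protected theorem aeval (y : D) (p : k[X]) : IsRationalIn k y (aeval y p) :=
  ⟨1, p, one_ne_zero, by simp⟩

theorem add (hf : IsRationalIn k y f) (hf' : IsRationalIn k y f') :
    IsRationalIn k y (f + f') := by
  obtain ⟨p, r, hp, h⟩ := hf
  obtain ⟨p', r', hp', h'⟩ := hf'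
  refine ⟨p * p', p' * r + p * r', mul_ne_zero hp hp', ?_⟩
  rw [map_add, map_mul, map_mul, map_mul, ← h, ← h', mul_add, aeval_mul_aeval_comm y p p']
  simp only [mul_assoc]
  rw [← mul_assoc (aeval y p') (aeval y p) f', aeval_mul_aeval_comm y p' p, mul_assoc]

theorem mul (hf : IsRationalIn k y f) (hf' : IsRationalIn k y f') :
    IsRationalIn k y (f * f') := by
  obtain ⟨p, r, hp, h⟩ := hf
  obtain ⟨p', r', hp', h'⟩ := hf'
  refine ⟨p' * p, r * r', mul_ne_zero hp' hp, ?_⟩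
  rw [map_mul, map_mul, ← h', mul_assoc, ← mul_assoc (aeval y p), h, ← mul_assoc, ← mul_assoc,
    aeval_mul_aeval_comm]

theorem smul (c : k) (hf : IsRationalIn k y f) : IsRationalIn k y (c • f) := by
  simpa [Algebra.smul_def] using (IsRationalIn.aeval y (C c)).mul hf

theorem neg (hf : IsRationalIn k y f) : IsRationalIn k y (-f) := by
  simpa using hf.smul (-1)

protected theorem self (y : D) : IsRationalIn k y y := by
  simpa using IsRationalIn.aeval y (X : k[X])

theorem inv_aeval {p : k[X]} (hp : aeval y p ≠ 0) : IsRationalIn k y (aeval y p)⁻¹ :=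
  ⟨p, 1, by rintro rfl; simp at hp, by rw [mul_inv_cancel₀ hp, map_one]⟩

theorem inv_self (hy : y ≠ 0) : IsRationalIn k y y⁻¹ := by
  simpa using inv_aeval (y := y) (p := (X : k[X])) (by simpa using hy)

end IsRationalIn

namespace IsQDivisionRing

open Polynomial

variable {k D : Type*} [Field k] [DivisionRing D] [Algebra k D] {q : k} {x y : D}

theorem mul_eq_smul (hD : IsQDivisionRing k D q x y) : x * y = q • (y * x) := by
  rw [hD.rel, Algebra.smul_def]

theorem aeval_ne_zero (hD : IsQDivisionRing k D q x y) {p : k[X]} (hp : p ≠ 0) :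
    aeval y p ≠ 0 := by
  have h : LinearIndependent k fun i : ℕ => y ^ i := by
    simpa [Function.comp_def] using hD.monomials_linearIndependent.comp (fun i : ℕ => (i, 0))
      fun i j hij => (Prod.mk.inj hij).1
  contrapose! hp
  rw [aeval_eq_sum_range, Finset.sum_range fun i => p.coeff i • y ^ i] at hp
  have h' := h.comp (fun i : Fin (p.natDegree + 1) => (i : ℕ)) Fin.val_injective
  have := Fintype.linearIndependent_iff.1 h' (fun i => p.coeff i) hp
  rw [← leadingCoeff_eq_zero]
  exact this ⟨p.natDegree, Nat.lt_succ_self _⟩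

theorem mul_aeval_of_mul_eq_smul {u : D} {c : k} (h : u * y = c • (y * u)) (p : k[X]) :
    u * aeval y p = aeval y (p.comp (C c * X)) * u := by
  induction p using Polynomial.induction_on' with
  | add p r hp hr => rw [map_add, mul_add, hp, hr, add_comp, map_add, add_mul]
  | monomial n a =>
    have := pow_mul_pow_of_mul_eq_smul h 1 n
    simp only [pow_one, one_mul] at this
    simp [monomial_comp, aeval_monomial, ← Algebra.smul_def, mul_pow, this, ← map_pow,
      smul_smul]
    rw [map_pow, aeval_X, mul_comm]

theorem zpow_mul (hD : IsQDivisionRing k D q x y) (hq : q ≠ 0) (n : ℤ) :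
    x ^ n * y = q ^ n • (y * x ^ n) := by
  have hinv : x⁻¹ * y = q⁻¹ • (y * x⁻¹) := by
    apply mul_left_cancel₀ hD.x_ne_zero
    rw [mul_inv_cancel_left₀ hD.x_ne_zero, mul_smul_comm, ← mul_assoc, hD.mul_eq_smul,
      smul_mul_assoc, inv_smul_smul₀ hq, mul_inv_cancel_right₀ hD.x_ne_zero]
  obtain ⟨m, rfl | rfl⟩ := n.eq_nat_or_neg
  · simpa using pow_mul_pow_of_mul_eq_smul hD.mul_eq_smul m 1
  · simpa using pow_mul_pow_of_mul_eq_smul hinv m 1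

theorem isRationalIn_conj (hD : IsQDivisionRing k D q x y) (hq : q ≠ 0) (n : ℤ) {f : D}
    (hf : IsRationalIn k y f) : IsRationalIn k y (x ^ n * f * x ^ (-n)) := by
  obtain ⟨p, r, hp, h⟩ := hf
  refine ⟨p.comp (C (q ^ n) * X), r.comp (C (q ^ n) * X), ?_, ?_⟩
  · rwa [Ne, comp_C_mul_X_eq_zero_iff]
    exact mem_nonZeroDivisors_of_ne_zero (zpow_ne_zero n hq)
  · have hn := hD.zpow_mul hq n
    rw [← mul_assoc, ← mul_assoc, ← mul_aeval_of_mul_eq_smul hn, mul_assoc (x ^ n), h,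
      mul_aeval_of_mul_eq_smul hn, mul_assoc, zpow_neg,
      mul_inv_cancel₀ (zpow_ne_zero n hD.x_ne_zero), mul_one]

end IsQDivisionRing

/-- The `k`-span of the elements `f * x ^ j` with `f` rational in `y` and `j ≤ n`. -/
def xDegreeLE (k : Type*) [Field k] {D : Type*} [DivisionRing D] [Algebra k D] (x y : D) (n : ℤ) :
    Submodule k D :=
  Submodule.span k {d | ∃ f, IsRationalIn k y f ∧ ∃ j ≤ n, d = f * x ^ j}

section xDegreeLE

variable {k D : Type*} [Field k] [DivisionRing D] [Algebra k D] {q : k} {x y : D}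

theorem mul_zpow_mem_xDegreeLE {f : D} (hf : IsRationalIn k y f) {j n : ℤ} (hj : j ≤ n) :
    f * x ^ j ∈ xDegreeLE k x y n :=
  Submodule.subset_span ⟨f, hf, j, hj, rfl⟩

theorem xDegreeLE_mono {m n : ℤ} (h : m ≤ n) : xDegreeLE k x y m ≤ xDegreeLE k x y n := by
  refine Submodule.span_mono ?_
  rintro _ ⟨f, hf, j, hj, rfl⟩
  exact ⟨f, hf, j, hj.trans h, rfl⟩

theorem mul_mem_xDegreeLE (hD : IsQDivisionRing k D q x y) (hq : q ≠ 0) {m n : ℤ} {d e : D}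
    (hd : d ∈ xDegreeLE k x y m) (he : e ∈ xDegreeLE k x y n) :
    d * e ∈ xDegreeLE k x y (m + n) := by
  have h : xDegreeLE k x y m * xDegreeLE k x y n ≤ xDegreeLE k x y (m + n) := by
    rw [xDegreeLE, xDegreeLE, Submodule.span_mul_span, Submodule.span_le]
    rintro _ ⟨_, ⟨f, hf, i, hi, rfl⟩, _, ⟨f', hf', j, hj, rfl⟩, rfl⟩
    have : f * x ^ i * (f' * x ^ j) = f * (x ^ i * f' * x ^ (-i)) * x ^ (i + j) := by
      rw [zpow_add₀ hD.x_ne_zero, zpow_neg]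
      simp only [mul_assoc, inv_mul_cancel_left₀ (zpow_ne_zero i hD.x_ne_zero)]
    simp only [this, SetLike.mem_coe]
    exact mul_zpow_mem_xDegreeLE (hf.mul (hD.isRationalIn_conj hq i hf')) (add_le_add hi hj)
  exact h (Submodule.mul_mem_mul hd he)

theorem mul_sub_mul_mem_xDegreeLE (hD : IsQDivisionRing k D q x y) (hq : q ≠ 0) {m n : ℤ}
    {d d' e e' : D} (hd : d - d' ∈ xDegreeLE k x y (m - 1)) (hd' : d' ∈ xDegreeLE k x y m)
    (he : e - e' ∈ xDegreeLE k x y (n - 1)) (he' : e' ∈ xDegreeLE k x y n) :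
    d * e - d' * e' ∈ xDegreeLE k x y (m + n - 1) := by
  have he'' : e ∈ xDegreeLE k x y n := by
    simpa using add_mem (xDegreeLE_mono (by lia) he) he'
  have : d * e - d' * e' = (d - d') * e + d' * (e - e') := by noncomm_ring
  rw [this]
  refine add_mem ?_ ?_
  · convert mul_mem_xDegreeLE hD hq hd he'' using 2; ring
  · convert mul_mem_xDegreeLE hD hq hd' he using 2; ring

theorem pow_mem_xDegreeLE (hD : IsQDivisionRing k D q x y) (hq : q ≠ 0) {n : ℤ} {d : D}
    (hd : d ∈ xDegreeLE k x y n) (i : ℕ) : d ^ i ∈ xDegreeLE k x y (i * n) := by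
  induction i with
  | zero =>
    simpa using mul_zpow_mem_xDegreeLE (k := k) (x := x) (IsRationalIn.aeval y 1) (le_refl 0)
  | succ i ih =>
    rw [pow_succ]
    convert mul_mem_xDegreeLE hD hq ih hd using 2
    push_cast; ring

theorem pow_sub_pow_mem_xDegreeLE (hD : IsQDivisionRing k D q x y) (hq : q ≠ 0) {n : ℤ} {d e : D}
    (hd : d - e ∈ xDegreeLE k x y (n - 1)) (he : e ∈ xDegreeLE k x y n) (i : ℕ) :
    d ^ i - e ^ i ∈ xDegreeLE k x y (i * n - 1) := by
  induction i with
  | zero => simp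
  | succ i ih =>
    rw [pow_succ, pow_succ]
    convert mul_sub_mul_mem_xDegreeLE hD hq ih (pow_mem_xDegreeLE hD hq he i) hd he using 2
    push_cast; ring

open Polynomial in
theorem aeval_mul_pow_mem_span (p : k[X]) (l : ℕ) :
    aeval y p * x ^ l ∈
      Submodule.span k ((fun p : ℕ × ℕ => y ^ p.1 * x ^ p.2) '' {p | p.2 = l}) := by
  rw [aeval_eq_sum_range, Finset.sum_mul]
  refine sum_mem fun i _ => ?_
  rw [smul_mul_assoc]
  exact Submodule.smul_mem _ _ (Submodule.subset_span ⟨(i, l), rfl, rfl⟩)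

open Polynomial in
theorem aeval_mul_mem_span (p : k[X]) (m : ℤ) {d : D}
    (hd : d ∈ Submodule.span k ((fun p : ℕ × ℕ => y ^ p.1 * x ^ p.2) '' {p | (p.2 : ℤ) < m})) :
    aeval y p * d ∈
      Submodule.span k ((fun p : ℕ × ℕ => y ^ p.1 * x ^ p.2) '' {p | (p.2 : ℤ) < m}) := by
  induction hd using Submodule.span_induction with
  | mem d hd =>
    obtain ⟨⟨i, j⟩, hj, rfl⟩ := hd
    have := aeval_mul_pow_mem_span (x := x) (y := y) (p * X ^ i) j
    rw [map_mul, map_pow, aeval_X, mul_assoc] at this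
    refine Submodule.span_mono (Set.image_mono ?_) this
    rintro ⟨a, b⟩ rfl
    exact hj
  | zero => simp
  | add _ _ _ _ h₁ h₂ => rw [mul_add]; exact add_mem h₁ h₂
  | smul c _ _ h => rw [mul_smul_comm]; exact Submodule.smul_mem _ _ h

open Polynomial in
theorem exists_aeval_mul_mul_pow_mem_span (hx : x ≠ 0) {n : ℤ} {d : D}
    (hd : d ∈ xDegreeLE k x y n) :
    ∃ p : k[X], p ≠ 0 ∧ ∃ N₀ : ℕ, ∀ N ≥ N₀, aeval y p * d * x ^ N ∈
      Submodule.span k ((fun p : ℕ × ℕ => y ^ p.1 * x ^ p.2) '' {p | (p.2 : ℤ) < n + N + 1}) := by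
  induction hd using Submodule.span_induction with
  | mem d hd =>
    obtain ⟨f, ⟨p, r, hp, h⟩, j, hj, rfl⟩ := hd
    refine ⟨p, hp, j.natAbs, fun N hN => ?_⟩
    obtain ⟨l, hl⟩ : ∃ l : ℕ, j + N = l := ⟨(j + N).toNat, by lia⟩
    rw [← mul_assoc, h, mul_assoc, ← zpow_natCast, ← zpow_add₀ hx, hl, zpow_natCast]
    refine Submodule.span_mono (Set.image_mono ?_) (aeval_mul_pow_mem_span r l)
    rintro ⟨a, b⟩ rfl
    simp only [Set.mem_ofPred_eq]
    lia
  | zero => exact ⟨1, one_ne_zero, 0, by simp⟩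
  | add d e _ _ h₁ h₂ =>
    obtain ⟨p, hp, N₁, h₁⟩ := h₁
    obtain ⟨r, hr, N₂, h₂⟩ := h₂
    refine ⟨p * r, mul_ne_zero hp hr, max N₁ N₂, fun N hN => ?_⟩
    rw [mul_add, add_mul]
    refine add_mem ?_ ?_
    · rw [mul_comm, map_mul, mul_assoc, mul_assoc, ← mul_assoc (aeval y p)]
      exact aeval_mul_mem_span _ _ (h₁ N (le_of_max_le_left hN))
    · rw [map_mul, mul_assoc, mul_assoc, ← mul_assoc (aeval y r)]
      exact aeval_mul_mem_span _ _ (h₂ N (le_of_max_le_right hN))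
  | smul c d _ h =>
    obtain ⟨p, hp, N₀, h⟩ := h
    refine ⟨p, hp, N₀, fun N hN => ?_⟩
    rw [mul_smul_comm, smul_mul_assoc]
    exact Submodule.smul_mem _ _ (h N hN)

open Polynomial in
theorem eq_zero_of_mul_zpow_mem_xDegreeLE (hD : IsQDivisionRing k D q x y) {f : D}
    (hf : IsRationalIn k y f) {n : ℤ} (h : f * x ^ n ∈ xDegreeLE k x y (n - 1)) : f = 0 := by
  obtain ⟨p, hp, N₀, hN⟩ := exists_aeval_mul_mul_pow_mem_span hD.x_ne_zero h
  obtain ⟨p', r, hp', hr⟩ := hf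
  obtain ⟨N, hN₀, l, hl⟩ : ∃ N ≥ N₀, ∃ l : ℕ, n + N = l :=
    ⟨max N₀ n.natAbs, le_max_left _ _, (n + max N₀ n.natAbs : ℤ).toNat, by lia⟩
  have h1 := aeval_mul_mem_span p' _ (hN N hN₀)
  have h2 : aeval y p' * (aeval y p * (f * x ^ n) * x ^ N) = aeval y (p * r) * x ^ l := by
    rw [← zpow_natCast x N, ← zpow_natCast x l, ← hl, zpow_add₀ hD.x_ne_zero, map_mul, ← hr]
    simp only [← mul_assoc]
    rw [IsRationalIn.aeval_mul_aeval_comm]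
  rw [h2] at h1
  have h3 := Submodule.disjoint_def.1 (hD.monomials_linearIndependent.disjoint_span_image
    (s := {p | p.2 = l}) (t := {p | (p.2 : ℤ) < n - 1 + N + 1}) (by
      rw [Set.disjoint_left]
      rintro ⟨a, b⟩ rfl
      simp only [Set.mem_ofPred_eq]
      lia)) _ (aeval_mul_pow_mem_span (p * r) l) h1
  rw [map_mul, ← hr] at h3
  simpa [hD.x_ne_zero, hD.aeval_ne_zero hp, hD.aeval_ne_zero hp'] using h3

end xDegreeLE

open Polynomial in
theorem linearIndependent_of_sub_mem_xDegreeLE {k D : Type*} [Field k] [DivisionRing D]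
    [Algebra k D] {q : k} {x y : D} (hD : IsQDivisionRing k D q x y) (hq : q ≠ 0) {B h w : D}
    (hB0 : B ≠ 0) (hB : IsRationalIn k y (B * x⁻¹)) (hBy : B * y = q • (y * B))
    (hh : h - B ∈ xDegreeLE k x y 0) (hw : w + q • (y * (B * B)) ∈ xDegreeLE k x y 1) :
    LinearIndependent k fun p : ℕ × ℕ => w ^ p.1 * h ^ p.2 := by
  have hx := hD.x_ne_zero
  have hBmem : B ∈ xDegreeLE k x y 1 := by
    have := mul_zpow_mem_xDegreeLE (x := x) hB (le_refl 1)
    rwa [zpow_one, inv_mul_cancel_right₀ hx] at this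
  have hymem : y ∈ xDegreeLE k x y 0 := by
    simpa using mul_zpow_mem_xDegreeLE (k := k) (x := x) (IsRationalIn.self y) (le_refl 0)
  set E : D := -(q • (y * (B * B))) with hE
  have hEmem : E ∈ xDegreeLE k x y 2 := by
    refine neg_mem (Submodule.smul_mem _ _ ?_)
    simpa using mul_mem_xDegreeLE hD hq hymem (mul_mem_xDegreeLE hD hq hBmem hBmem)
  have hwE : w - E ∈ xDegreeLE k x y (2 - 1) := by rw [hE, sub_neg_eq_add]; exact hw
  have lead : ∀ i j : ℕ, w ^ i * h ^ j - E ^ i * B ^ j ∈ xDegreeLE k x y ((2 * i + j : ℕ) - 1) := by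
    intro i j
    have := mul_sub_mul_mem_xDegreeLE hD hq (pow_sub_pow_mem_xDegreeLE hD hq hwE hEmem i)
      (pow_mem_xDegreeLE hD hq hEmem i) (pow_sub_pow_mem_xDegreeLE hD hq (n := 1) hh hBmem j)
      (pow_mem_xDegreeLE hD hq hBmem j)
    convert this using 2
    push_cast; ring
  have hEB : ∀ i j : ℕ, ∃ c : k, c ≠ 0 ∧ E ^ i * B ^ j = c • (y ^ i * B ^ (2 * i + j)) := by
    intro i j
    induction i with
    | zero => exact ⟨1, one_ne_zero, by simp⟩
    | succ i ih =>
      obtain ⟨c, hc, ih⟩ := ih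
      refine ⟨-(q * c * q ^ (2 * i)), by simp [hq, hc], ?_⟩
      have h2 := pow_mul_pow_of_mul_eq_smul hBy 2 i
      have h3 : B ^ (2 * (i + 1) + j) = B ^ 2 * B ^ (2 * i + j) := by
        rw [← pow_add]; congr 1; ring
      rw [pow_succ', mul_assoc, ih, hE, h3, pow_succ' y, ← pow_two, neg_mul, smul_mul_assoc,
        mul_smul_comm, smul_smul, neg_smul, mul_assoc y, ← mul_assoc (B ^ 2), h2, smul_mul_assoc,
        mul_smul_comm, smul_smul]
      simp only [mul_assoc]
  choose c hc hEB using hEB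
  have wmem : ∀ i j : ℕ, w ^ i * h ^ j ∈ xDegreeLE k x y (2 * i + j : ℕ) := by
    intro i j
    have h1 := mul_mem_xDegreeLE hD hq (pow_mem_xDegreeLE hD hq hEmem i)
      (pow_mem_xDegreeLE hD hq hBmem j)
    have h2 : (i : ℤ) * 2 + j * 1 = (2 * i + j : ℕ) := by push_cast; ring
    rw [h2] at h1
    simpa using add_mem (xDegreeLE_mono (by lia) (lead i j)) h1
  have hBrat : ∀ N : ℕ, IsRationalIn k y (B ^ N * x ^ (-(N : ℤ))) := by
    intro N
    induction N with
    | zero => simpa using IsRationalIn.aeval y (1 : k[X])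
    | succ N ih =>
      have := hB.mul (hD.isRationalIn_conj hq 1 ih)
      convert this using 1
      rw [pow_succ', Nat.cast_succ, neg_add, zpow_add₀ hx, zpow_one]
      simp only [mul_assoc, inv_mul_cancel_left₀ hx]
  classical
  rw [linearIndependent_iff']
  intro s a hsum p hp
  by_contra hap
  set T := s.filter fun p => a p ≠ 0 with hT
  obtain ⟨m, hmT, hmax⟩ := T.exists_max_image (fun p => 2 * p.1 + p.2)
    ⟨p, Finset.mem_filter.2 ⟨hp, hap⟩⟩
  set N := 2 * m.1 + m.2 with hN
  have hsumT : ∑ p ∈ T, a p • (w ^ p.1 * h ^ p.2) = 0 := by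
    rw [← hsum]
    refine Finset.sum_filter_of_ne fun p _ hp h0 => hp ?_
    rw [h0, zero_smul]
  set P : k[X] := ∑ p ∈ T.filter fun p => 2 * p.1 + p.2 = N, monomial p.1 (a p * c p.1 p.2)
    with hP
  have hPB : aeval y P * B ^ N = ∑ p ∈ T.filter fun p => 2 * p.1 + p.2 = N,
      a p • (E ^ p.1 * B ^ p.2) := by
    rw [hP, map_sum, Finset.sum_mul]
    refine Finset.sum_congr rfl fun p hp => ?_
    rw [hEB, (Finset.mem_filter.1 hp).2, aeval_monomial, ← Algebra.smul_def, smul_mul_assoc,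
      smul_smul]
  have hmem : aeval y P * B ^ N ∈ xDegreeLE k x y (N - 1) := by
    rw [← Finset.sum_filter_add_sum_filter_not T fun p => 2 * p.1 + p.2 = N] at hsumT
    have h1 : ∑ p ∈ T.filter (fun p => 2 * p.1 + p.2 = N),
        a p • (w ^ p.1 * h ^ p.2 - E ^ p.1 * B ^ p.2) ∈ xDegreeLE k x y (N - 1) := by
      refine sum_mem fun p hp => Submodule.smul_mem _ _ ?_
      rw [← (Finset.mem_filter.1 hp).2]
      exact lead _ _
    have h2 : ∑ p ∈ T.filter (fun p => ¬ 2 * p.1 + p.2 = N),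
        a p • (w ^ p.1 * h ^ p.2) ∈ xDegreeLE k x y (N - 1) := by
      refine sum_mem fun p hp => Submodule.smul_mem _ _ (xDegreeLE_mono ?_ (wmem _ _))
      have := hmax p (Finset.mem_filter.1 hp).1
      have := (Finset.mem_filter.1 hp).2
      lia
    simp only [smul_sub, Finset.sum_sub_distrib, ← hPB] at h1
    rw [← Submodule.neg_mem_iff]
    convert add_mem h1 h2 using 1
    linear_combination (norm := abel) -hsumT
  have hP0 : P = 0 := by
    by_contra hP0
    have h1 : aeval y P * B ^ N = aeval y P * (B ^ N * x ^ (-(N : ℤ))) * x ^ (N : ℤ) := by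
      rw [mul_assoc, mul_assoc, ← zpow_add₀ hx, neg_add_cancel, zpow_zero, mul_one]
    rw [h1] at hmem
    have h2 := eq_zero_of_mul_zpow_mem_xDegreeLE hD ((IsRationalIn.aeval y P).mul (hBrat N)) hmem
    exact mul_ne_zero (hD.aeval_ne_zero hP0)
      (mul_ne_zero (pow_ne_zero _ hB0) (zpow_ne_zero _ hx)) h2
  have hcoeff : P.coeff m.1 = a m * c m.1 m.2 := by
    rw [hP, finsetSum_coeff, Finset.sum_eq_single m]
    · exact coeff_monomial_same _ _
    · intro p hp hpm
      rw [coeff_monomial, if_neg]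
      intro h1
      have := (Finset.mem_filter.1 hp).2
      exact hpm (Prod.ext h1 (by lia))
    · intro h1
      exact (h1 (Finset.mem_filter.2 ⟨hmT, hN.symm⟩)).elim
  rw [hP0, coeff_zero] at hcoeff
  exact mul_ne_zero (Finset.mem_filter.1 hmT).2 (hc _ _) hcoeff.symm

section Invariants

variable {k D : Type*} [Field k] [DivisionRing D] [Algebra k D]
  {q : k} {x x' y y' h g : D}

theorem two_smul_eq_of_sub_mul_eq (h1 : x * y = q • (y * x)) (h2 : x' * y' = q • (y' * x'))
    (h7 : y * y' = -1) (h8 : y' * y = -1) (hb : y - y' ≠ 0)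
    (hh : (y - y') * h = x - x') (hg : (y - y') * g = x * y - x' * y') :
    (2 : k) • g = q • ((y + y') * h + (x + x')) := by
  apply mul_left_cancel₀ hb
  have hbm : (y - y') * (y + y') = (y + y') * (y - y') := by
    simp only [sub_mul, mul_add, mul_sub, add_mul, h7, h8]; abel
  rw [mul_smul_comm, mul_smul_comm, mul_add, ← mul_assoc, hbm, mul_assoc, hh, hg]
  linear_combination (norm := skip) (2 : k) • h1 - (2 : k) • h2
  simp only [mul_add, add_mul, mul_sub, sub_mul]
  module

theorem add_mul_sub_eq (hh : (y - y') * h = x - x') (hg : (y - y') * g = x * y - x' * y') :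
    (x + x') * (y - y') = (y - y') * ((2 : k) • g - h * (y + y')) := by
  rw [mul_sub (y - y'), mul_smul_comm, ← mul_assoc, hh, hg]
  simp only [mul_add, add_mul, mul_sub, sub_mul]
  module

theorem mul_eq_smul_mul_add [CharZero k] (hq : q ≠ 0) (h1 : x * y = q • (y * x))
    (h2 : x' * y' = q • (y' * x')) (h5 : x' * x = -y' - q⁻¹ • y) (h6 : x * x' = -(q⁻¹ • y') - y)
    (h7 : y * y' = -1) (h8 : y' * y = -1) (hb : y - y' ≠ 0)
    (hh : (y - y') * h = x - x') (hg : (y - y') * g = x * y - x' * y') :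
    h * g = q • (g * h) + (1 - q) • (1 : D) := by
  have h2g := two_smul_eq_of_sub_mul_eq h1 h2 h7 h8 hb hh hg
  have hc := add_mul_sub_eq (k := k) hh hg
  have he : x + x' = (2 * q⁻¹) • g - (y + y') * h := by
    rw [mul_comm, mul_smul, h2g, inv_smul_smul₀ hq]; abel
  have h3 : h * (x + x') - ((2 : k) • g - h * (y + y')) * h = (-2 * (1 - q⁻¹)) • (1 : D) := by
    apply mul_left_cancel₀ hb
    rw [mul_sub, ← mul_assoc, ← mul_assoc, ← hc, mul_assoc (x + x'), hh]
    linear_combination (norm := skip) (2 : k) • h6 - (2 : k) • h5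
    simp only [mul_add, add_mul, mul_sub, sub_mul, mul_smul_comm, mul_one]
    module
  rw [he] at h3
  have h4 : h * g = (q * 2⁻¹) • (h * ((2 * q⁻¹) • g - (y + y') * h) -
      ((2 : k) • g - h * (y + y')) * h) + q • (g * h) := by
    simp only [mul_sub, sub_mul, mul_smul_comm, smul_mul_assoc, mul_assoc, mul_add, add_mul,
      smul_sub, smul_smul, smul_add]
    match_scalars <;> field_simp <;> ring
  rw [h4, h3, smul_smul, add_comm]
  congr 2
  field_simp
  ring

theorem sub_mul_sub_eq (h1 : x * y = q • (y * x)) (h2 : x' * y' = q • (y' * x'))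
    (hh : (y - y') * h = x - x') :
    (x - x') * (y - y') = q • ((y + y') * (x + x') + (y - y') * ((y - y') * h)) -
      (x + x') * (y + y') := by
  rw [hh]
  linear_combination (norm := skip) (2 : k) • h1 + (2 : k) • h2
  simp only [mul_add, add_mul, mul_sub, sub_mul]
  module

theorem add_mul_one_sub_eq [CharZero k] (hq : q ≠ 0) (h5 : x' * x = -y' - q⁻¹ • y)
    (h6 : x * x' = -(q⁻¹ • y') - y) (h7 : y * y' = -1) (h8 : y' * y = -1)
    (hh : (y - y') * h = x - x')
    (h2g : (2 : k) • g = q • ((y + y') * h + (x + x')))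
    (hhg : h * g = q • (g * h) + (1 - q) • (1 : D))
    (hab : (x - x') * (y - y') = q • ((y + y') * (x + x') + (y - y') * ((y - y') * h)) -
      (x + x') * (y + y')) :
    (y + y') * (1 - g * h) = q • (h * h) - (q⁻¹ * q⁻¹) • (g * g) := by
  have he : x + x' = (2 * q⁻¹) • g - (y + y') * h := by
    rw [mul_comm, mul_smul, h2g, inv_smul_smul₀ hq]; abel
  have hbb : (y - y') * (y - y') = (y + y') * (y + y') + (4 : k) • (1 : D) := by
    simp only [mul_add, add_mul, mul_sub, sub_mul, h7, h8]
    module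
  have hsq : (x + x') * (x + x') - (x - x') * (y - y') * h = (-2 * (1 + q⁻¹)) • (y + y') := by
    rw [mul_assoc, hh]
    linear_combination (norm := skip) (2 : k) • h6 + (2 : k) • h5
    simp only [mul_add, add_mul, mul_sub, sub_mul]
    module
  rw [hab, ← mul_assoc (y - y'), hbb, he] at hsq
  generalize y + y' = m at *
  have hhg' : m * (h * g) = m * (q • (g * h) + (1 - q) • (1 : D)) := by rw [hhg]
  simp only [mul_sub, sub_mul, mul_smul_comm, smul_mul_assoc, mul_assoc, mul_add, add_mul,
      smul_sub, smul_smul, smul_add, mul_one, one_mul] at hsq hhg' ⊢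
  linear_combination (norm := skip) (4 : k)⁻¹ • hsq + (2 * q)⁻¹ • hhg'
  match_scalars <;> field_simp <;> ring

end Invariants

/-- The division subring of `D` generated over `k` by `s`, bundled as a `Subfield`. -/
def divisionClosure (k : Type*) [Field k] {D : Type*} [DivisionRing D] [Algebra k D]
    (s : Set D) : Subfield D where
  carrier := {d | MemDivisionClosure k s d}
  mul_mem' := .mul
  one_mem' := by simpa using MemDivisionClosure.scalar (s := s) (1 : k)
  add_mem' := .add
  zero_mem' := by simpa using MemDivisionClosure.scalar (s := s) (0 : k)
  neg_mem' := .neg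
  inv_mem' _ := .inv

theorem smul_mem_divisionClosure {k D : Type*} [Field k] [DivisionRing D] [Algebra k D]
    {s : Set D} (c : k) {d : D} (hd : d ∈ divisionClosure k s) :
    c • d ∈ divisionClosure k s := by
  rw [Algebra.smul_def]
  exact mul_mem (MemDivisionClosure.scalar c) hd

theorem divisionClosure_induction_conj {k D : Type*} [Field k] [DivisionRing D] [Algebra k D]
    {s : Set D} {b : D} (hb : b ≠ 0) (hs : ∀ d ∈ s, b * d * b⁻¹ ∈ divisionClosure k s) {d : D}
    (hd : d ∈ divisionClosure k s) : b * d * b⁻¹ ∈ divisionClosure k s := by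
  induction hd with
  | mem h => exact hs _ h
  | scalar c =>
    rw [← Algebra.commutes, mul_assoc, mul_inv_cancel₀ hb, mul_one]
    exact .scalar c
  | add _ _ h₁ h₂ => rw [mul_add, add_mul]; exact add_mem h₁ h₂
  | neg _ h => rw [mul_neg, neg_mul]; exact neg_mem h
  | @mul u v _ _ h₁ h₂ =>
    have : b * (u * v) * b⁻¹ = b * u * b⁻¹ * (b * v * b⁻¹) := by
      simp only [mul_assoc, inv_mul_cancel_left₀ hb]
    rw [this]
    exact mul_mem h₁ h₂
  | @inv u _ h =>
    have : b * u⁻¹ * b⁻¹ = (b * u * b⁻¹)⁻¹ := by simp [mul_assoc]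
    rw [this]
    exact inv_mem h

/-- If `b` is anti-invariant under `φ`, normalises the subfield `R` of the fixed ring, satisfies
`b² ∈ R`, and `R + R b` contains a subalgebra whose fractions exhaust `D`, then every fixed
element lies in `R`. -/
theorem fixed_mem_of_add_mul {k D : Type*} [Field k] [CharZero k] [DivisionRing D] [Algebra k D]
    (R : Subfield D) (φ : D →ₐ[k] D) {b : D} (hb : b ≠ 0) (hφb : φ b = -b)
    (hφR : ∀ r ∈ R, φ r = r) (hconj : ∀ r ∈ R, b⁻¹ * r * b ∈ R) (A : Subalgebra k D)
    (hA : ∀ d ∈ A, ∃ r₀ ∈ R, ∃ r₁ ∈ R, d = r₀ + r₁ * b)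
    (hfrac : ∀ d : D, ∃ s ∈ A, ∃ t ∈ A, t ≠ 0 ∧ t * d = s) {r : D} (hr : φ r = r) : r ∈ R := by
  have : CharZero D := charZero_of_injective_algebraMap (algebraMap k D).injective
  obtain ⟨s, hs, t, ht, ht0, h⟩ := hfrac r
  obtain ⟨s₀, hs₀, s₁, hs₁, rfl⟩ := hA s hs
  obtain ⟨t₀, ht₀, t₁, ht₁, rfl⟩ := hA t ht
  have h' := congrArg φ h
  simp only [map_mul, map_add, hr, hφb, hφR _ hs₀, hφR _ hs₁, hφR _ ht₀, hφR _ ht₁] at h'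
  have e₀ : t₀ * r = s₀ := by
    have : (2 : D) * (t₀ * r) = 2 * s₀ := by linear_combination (norm := noncomm_ring) h + h'
    exact mul_left_cancel₀ two_ne_zero this
  have e₁ : t₁ * b * r = s₁ * b := by
    have : (2 : D) * (t₁ * b * r) = 2 * (s₁ * b) := by
      linear_combination (norm := noncomm_ring) h - h'
    exact mul_left_cancel₀ two_ne_zero this
  by_cases h0 : t₀ = 0
  · have h1 : t₁ ≠ 0 := by
      rintro rfl
      simp [h0] at ht0
    have : r = b⁻¹ * (t₁⁻¹ * s₁) * b := by
      rw [mul_assoc, mul_assoc t₁⁻¹, ← e₁, mul_assoc, inv_mul_cancel_left₀ h1,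
        inv_mul_cancel_left₀ hb]
    rw [this]
    exact hconj _ (mul_mem (inv_mem ht₁) hs₁)
  · rw [← inv_mul_cancel_left₀ h0 r, e₀]
    exact mul_mem (inv_mem ht₀) hs₀

theorem exists_add_mul_of_mem_adjoin {k D : Type*} [Field k] [DivisionRing D]
    [Algebra k D] (R : Subfield D) (hkR : ∀ c : k, algebraMap k D c ∈ R) {b : D} (hb : b ≠ 0)
    (hconj : ∀ r ∈ R, b * r * b⁻¹ ∈ R) (hbb : b * b ∈ R) {s : Set D}
    (hs : ∀ d ∈ s, ∃ r₀ ∈ R, ∃ r₁ ∈ R, d = r₀ + r₁ * b) {d : D} (hd : d ∈ Algebra.adjoin k s) :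
    ∃ r₀ ∈ R, ∃ r₁ ∈ R, d = r₀ + r₁ * b := by
  induction hd using Algebra.adjoin_induction with
  | mem d hd => exact hs d hd
  | algebraMap c => exact ⟨_, hkR c, 0, zero_mem R, by simp⟩
  | add _ _ _ _ h₁ h₂ =>
    obtain ⟨u₀, hu₀, u₁, hu₁, rfl⟩ := h₁
    obtain ⟨v₀, hv₀, v₁, hv₁, rfl⟩ := h₂
    exact ⟨u₀ + v₀, add_mem hu₀ hv₀, u₁ + v₁, add_mem hu₁ hv₁, by noncomm_ring⟩
  | mul _ _ _ _ h₁ h₂ =>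
    obtain ⟨u₀, hu₀, u₁, hu₁, rfl⟩ := h₁
    obtain ⟨v₀, hv₀, v₁, hv₁, rfl⟩ := h₂
    have hc : ∀ v, b * v = b * v * b⁻¹ * b := fun v => (inv_mul_cancel_right₀ hb _).symm
    refine ⟨u₀ * v₀ + u₁ * ((b * v₁ * b⁻¹) * (b * b)),
      add_mem (mul_mem hu₀ hv₀) (mul_mem hu₁ (mul_mem (hconj _ hv₁) hbb)),
      u₀ * v₁ + u₁ * (b * v₀ * b⁻¹), add_mem (mul_mem hu₀ hv₁) (mul_mem hu₁ (hconj _ hv₀)), ?_⟩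
    have e₀ := hc v₀
    have e₁ := hc v₁
    linear_combination (norm := noncomm_ring) u₁ * e₀ + u₁ * e₁ * b

section Invariants

variable {k D : Type*} [Field k] [CharZero k] [DivisionRing D] [Algebra k D]
  {q : k} {x x' y y' h g : D}

theorem fixed_iff_memDivisionClosure (hq : q ≠ 0) (φ : D →ₐ[k] D)
    (hfrac : ∀ d : D, ∃ s ∈ Algebra.adjoin k {x, y}, ∃ t ∈ Algebra.adjoin k {x, y},
      t ≠ 0 ∧ t * d = s)
    (hφx : φ x = x') (hφx' : φ x' = x) (hφy : φ y = y') (hφy' : φ y' = y)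
    (h1 : x * y = q • (y * x)) (h2 : x' * y' = q • (y' * x'))
    (h5 : x' * x = -y' - q⁻¹ • y) (h6 : x * x' = -(q⁻¹ • y') - y)
    (h7 : y * y' = -1) (h8 : y' * y = -1) (hb : y - y' ≠ 0)
    (hh : (y - y') * h = x - x') (hg : (y - y') * g = x * y - x' * y')
    (hw : 1 - g * h ≠ 0) (r : D) :
    φ r = r ↔ MemDivisionClosure k ({h, g} : Set D) r := by
  have h2g := two_smul_eq_of_sub_mul_eq h1 h2 h7 h8 hb hh hg
  have hhg := mul_eq_smul_mul_add hq h1 h2 h5 h6 h7 h8 hb hh hg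
  have hab := sub_mul_sub_eq h1 h2 hh
  have hm := add_mul_one_sub_eq hq h5 h6 h7 h8 hh h2g hhg hab
  have hbb : (y - y') * (y - y') = (y + y') * (y + y') + (4 : k) • (1 : D) := by
    simp only [mul_add, add_mul, mul_sub, sub_mul, h7, h8]
    module
  have he : x + x' = (2 * q⁻¹) • g - (y + y') * h := by
    rw [mul_comm, mul_smul, h2g, inv_smul_smul₀ hq]; abel
  have hφb : φ (y - y') = -(y - y') := by rw [map_sub, hφy, hφy', neg_sub]
  have fixed_of_anti : ∀ d e, (y - y') * d = e → φ e = -e → φ d = d := by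
    rintro d _ rfl h
    rw [map_mul, hφb, neg_mul, neg_inj] at h
    exact mul_left_cancel₀ hb h
  set R := divisionClosure k ({h, g} : Set D) with hR
  have hhR : h ∈ R := MemDivisionClosure.mem (by simp)
  have hgR : g ∈ R := MemDivisionClosure.mem (by simp)
  have smulR : ∀ (c : k) {d : D}, d ∈ R → c • d ∈ R := fun c _ => smul_mem_divisionClosure c
  have hmR : y + y' ∈ R := by
    rw [← mul_inv_cancel_right₀ hw (y + y'), hm]
    exact mul_mem (sub_mem (smulR _ (mul_mem hhR hhR)) (smulR _ (mul_mem hgR hgR)))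
      (inv_mem (sub_mem (one_mem R) (mul_mem hgR hhR)))
  have heR : x + x' ∈ R := by
    rw [he]
    exact sub_mem (smulR _ hgR) (mul_mem hmR hhR)
  have hbbR : (y - y') * (y - y') ∈ R := by
    rw [hbb]
    exact add_mem (mul_mem hmR hmR) (smulR _ (one_mem R))
  have habR : (x - x') * (y - y')⁻¹ ∈ R := by
    have : (x - x') * (y - y')⁻¹ = (x - x') * (y - y') * ((y - y') * (y - y'))⁻¹ := by
      rw [mul_inv_rev, mul_assoc, mul_inv_cancel_left₀ hb]
    rw [this, hab, ← mul_assoc (y - y')]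
    exact mul_mem (sub_mem (smulR _ (add_mem (mul_mem hmR heR) (mul_mem hbbR hhR)))
      (mul_mem heR hmR)) (inv_mem hbbR)
  have hcR : (x * y - x' * y') * (y - y')⁻¹ ∈ R := by
    have hmb : (y + y') * (y - y')⁻¹ = (y - y')⁻¹ * (y + y') := by
      refine (Commute.inv_right₀ (?_ : (y + y') * (y - y') = (y - y') * (y + y'))).eq
      simp only [sub_mul, mul_add, mul_sub, add_mul, h7, h8]
      abel
    have : (x * y - x' * y') * (y - y')⁻¹ =
        (2 : k)⁻¹ • ((x + x') + (x - x') * (y - y')⁻¹ * (y + y')) := by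
      have h' : x * y - x' * y' = (2 : k)⁻¹ • ((x + x') * (y - y') + (x - x') * (y + y')) := by
        simp only [mul_add, add_mul, mul_sub, sub_mul]
        module
      rw [h', smul_mul_assoc, add_mul, mul_inv_cancel_right₀ hb, mul_assoc (x - x'), hmb,
        mul_assoc]
    rw [this]
    exact smulR _ (add_mem heR (mul_mem habR hmR))
  have hconj : ∀ r ∈ R, (y - y') * r * (y - y')⁻¹ ∈ R := by
    intro r hr
    refine divisionClosure_induction_conj hb ?_ hr
    rintro d (rfl | rfl)
    · rwa [hh]
    · rwa [hg]
  have hconj' : ∀ r ∈ R, (y - y')⁻¹ * r * (y - y') ∈ R := by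
    intro r hr
    have : (y - y')⁻¹ * r * (y - y') =
        ((y - y') * (y - y'))⁻¹ * ((y - y') * r * (y - y')⁻¹) * ((y - y') * (y - y')) := by
      simp only [mul_inv_rev, mul_assoc, inv_mul_cancel_left₀ hb]
    rw [this]
    exact mul_mem (mul_mem (inv_mem hbbR) (hconj r hr)) hbbR
  have hRφ : ∀ r ∈ R, φ r = r := by
    intro r hr
    induction hr with
    | mem h =>
      rcases h with rfl | rfl
      · exact fixed_of_anti _ _ hh (by rw [map_sub, hφx, hφx', neg_sub])
      · refine fixed_of_anti _ _ hg ?_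
        rw [map_sub, map_mul, map_mul, hφx, hφx', hφy, hφy', neg_sub]
    | scalar c => exact φ.commutes c
    | add _ _ h₁ h₂ => rw [map_add, h₁, h₂]
    | neg _ h => rw [map_neg, h]
    | mul _ _ h₁ h₂ => rw [map_mul, h₁, h₂]
    | inv _ h => rw [map_inv₀, h]
  refine ⟨fun hr => ?_, hRφ r⟩
  refine fixed_mem_of_add_mul R φ hb hφb hRφ hconj' (Algebra.adjoin k {x, y})
    (fun d hd => exists_add_mul_of_mem_adjoin R (fun c => MemDivisionClosure.scalar c) hb hconj
      hbbR ?_ hd) hfrac hr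
  rintro d (rfl | rfl)
  · refine ⟨(2 : k)⁻¹ • (d + x'), smulR _ heR,
      (2 : k)⁻¹ • ((d - x') * (y - y')⁻¹), smulR _ habR, ?_⟩
    rw [smul_mul_assoc, inv_mul_cancel_right₀ hb]
    module
  · refine ⟨(2 : k)⁻¹ • (d + y'), smulR _ hmR, (2 : k)⁻¹ • 1, smulR _ (one_mem R), ?_⟩
    rw [smul_mul_assoc, one_mul]
    module

end Invariants

/-- Let `G` be the group of `k`-algebra automorphisms of `D` generated by `φ`, and
`D^G = {r ∈ D : ψ(r) = r for all ψ ∈ G}` the fixed ring.  Then `D^G` equals the division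
subring `R` of `D` generated over `k` by `h` and `g`, and `D^G` is isomorphic to `D` as a
`k`-algebra (for the same `q`): there is an injective `k`-algebra endomorphism of `D` whose
range is exactly `D^G`. -/
theorem stmt6 (k : Type*) [Field k] [CharZero k] (q : k) (hq : q ≠ 0)
    (D : Type*) [DivisionRing D] [Algebra k D] (x y : D)
    (hD : IsQDivisionRing k D q x y)
    (φ : D ≃ₐ[k] D)
    (hφx : φ x = (y⁻¹ - (algebraMap k D q)⁻¹ * y) * x⁻¹)
    (hφy : φ y = -y⁻¹) :
    let Q : D := algebraMap k D q
    let Λ : D := y⁻¹ - Q⁻¹ * y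
    let a : D := x - Λ * x⁻¹
    let b : D := y + y⁻¹
    let c : D := x * y + Λ * (x⁻¹ * y⁻¹)
    let h : D := b⁻¹ * a
    let g : D := b⁻¹ * c
    let G : Subgroup (D ≃ₐ[k] D) := Subgroup.closure {φ}
    ({r : D | ∀ ψ ∈ G, ψ r = r} = {r : D | MemDivisionClosure k ({h, g} : Set D) r}) ∧
    ∃ F : D →ₐ[k] D, Function.Injective F ∧
      Set.range F = {r : D | ∀ ψ ∈ G, ψ r = r} := by
  intro Q Λ a b c h g G
  have hx := hD.x_ne_zero
  have hy := hD.y_ne_zero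
  have hQ : Q⁻¹ = algebraMap k D q⁻¹ := (map_inv₀ _ _).symm
  have h1 : x * y = q • (y * x) := hD.mul_eq_smul
  have hΛ : Λ = y⁻¹ - q⁻¹ • y := by simp only [Λ, hQ, Algebra.smul_def]
  have hφx' : φ x = Λ * x⁻¹ := hφx
  have hΛ0 : Λ ≠ 0 := by
    intro h0
    rw [h0, zero_mul] at hφx'
    exact hx ((map_eq_zero φ).1 hφx')
  have hφφx : φ (Λ * x⁻¹) = x := by
    have hxΛ : x * Λ = φ Λ * x := by
      have h2 : x * y⁻¹ = q⁻¹ • (y⁻¹ * x) := by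
        apply mul_right_cancel₀ hy
        rw [inv_mul_cancel_right₀ hy, smul_mul_assoc, mul_assoc, h1, mul_smul_comm,
          inv_mul_cancel_left₀ hy, inv_smul_smul₀ hq]
      rw [hΛ, mul_sub, mul_smul_comm, h1, h2, map_sub, map_smul, map_inv₀, hφy, inv_smul_smul₀ hq,
        sub_mul, inv_neg, inv_inv, neg_mul, smul_neg, neg_mul, smul_mul_assoc]
      abel
    rw [map_mul, map_inv₀, hφx', mul_inv_rev, inv_inv, ← mul_assoc, ← hxΛ,
      mul_inv_cancel_right₀ hΛ0]
  have hyy : y ^ 2 + 1 ≠ 0 := by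
    have := hD.aeval_ne_zero (p := Polynomial.X ^ 2 + Polynomial.C 1)
      (Polynomial.X_pow_add_C_ne_zero two_pos 1)
    simpa using this
  have hb' : b = y⁻¹ * (y ^ 2 + 1) := by
    rw [mul_add, mul_one, pow_two, inv_mul_cancel_left₀ hy]
  have hb : b ≠ 0 := by rw [hb']; exact mul_ne_zero (inv_ne_zero hy) hyy
  have hby : y - -y⁻¹ = b := sub_neg_eq_add _ _
  have hbinv : IsRationalIn k y b⁻¹ := by
    rw [hb', mul_inv_rev, inv_inv]
    refine IsRationalIn.mul ?_ (IsRationalIn.self y)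
    have := IsRationalIn.inv_aeval (k := k) (y := y)
      (p := Polynomial.X ^ 2 + 1) (by simpa using hyy)
    simpa using this
  have hbycomm : y * b⁻¹ = b⁻¹ * y := by
    refine (Commute.inv_right₀ (?_ : y * b = b * y)).eq
    simp only [b, mul_add, add_mul, mul_inv_cancel₀ hy, inv_mul_cancel₀ hy]
  have hΛrat : IsRationalIn k y Λ := by
    rw [hΛ, sub_eq_add_neg]
    exact (IsRationalIn.inv_self hy).add ((IsRationalIn.self y).smul _).neg
  have hbh : b * h = x - Λ * x⁻¹ := mul_inv_cancel_left₀ hb _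
  have hbg : b * g = x * y - Λ * x⁻¹ * -y⁻¹ := by
    rw [mul_neg, sub_neg_eq_add, mul_assoc]
    exact mul_inv_cancel_left₀ hb _
  set B : D := b⁻¹ * x with hBdef
  have hB0 : B ≠ 0 := mul_ne_zero (inv_ne_zero hb) hx
  have hBx : B * x⁻¹ = b⁻¹ := mul_inv_cancel_right₀ hx _
  have hBmem : B ∈ xDegreeLE k x y 1 := by
    simpa using mul_zpow_mem_xDegreeLE (x := x) hbinv (le_refl 1)
  have hBy : B * y = q • (y * B) := by
    rw [hBdef, mul_assoc, h1, mul_smul_comm, ← mul_assoc, ← hbycomm, mul_assoc]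
  have hhB : h - B ∈ xDegreeLE k x y 0 := by
    have : h - B = -(b⁻¹ * Λ) * x ^ (-1 : ℤ) := by
      simp only [h, a, B, zpow_neg_one]
      noncomm_ring
    rw [this]
    exact mul_zpow_mem_xDegreeLE (hbinv.mul hΛrat).neg (by norm_num)
  have hyBmem : q • (y * B) ∈ xDegreeLE k x y 1 := by
    rw [hBdef, ← mul_assoc, ← smul_mul_assoc]
    simpa using mul_zpow_mem_xDegreeLE (x := x) (((IsRationalIn.self y).mul hbinv).smul q)
      (le_refl 1)
  have hgB : g - q • (y * B) ∈ xDegreeLE k x y 0 := by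
    have : g - q • (y * B) = b⁻¹ * Λ * (x ^ (-1 : ℤ) * y⁻¹ * x ^ (- -1 : ℤ)) * x ^ (-1 : ℤ) := by
      rw [← hBy]
      simp only [g, c, B, zpow_neg_one, neg_neg, zpow_one, mul_add, mul_assoc,
        mul_inv_cancel₀ hx, mul_one, add_sub_cancel_left]
    rw [this]
    exact mul_zpow_mem_xDegreeLE ((hbinv.mul hΛrat).mul
      (hD.isRationalIn_conj hq (-1) (IsRationalIn.inv_self hy))) (by norm_num)
  set w : D := 1 - g * h with hwdef
  have hwB : w + q • (y * (B * B)) ∈ xDegreeLE k x y 1 := by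
    have h2 := mul_sub_mul_mem_xDegreeLE hD hq (m := 1) (n := 1) hgB hyBmem hhB hBmem
    have h3 : (1 : D) ∈ xDegreeLE k x y 1 := by
      simpa using mul_zpow_mem_xDegreeLE (k := k) (x := x) (IsRationalIn.aeval y 1) (zero_le_one)
    have h4 : w + q • (y * (B * B)) = 1 - (g * h - q • (y * B) * B) := by
      rw [hwdef, smul_mul_assoc, mul_assoc y B B]; abel
    rw [h4]
    exact sub_mem h3 h2
  have hind := linearIndependent_of_sub_mem_xDegreeLE hD hq hB0 (by rwa [hBx]) hBy hhB hwB
  have hw0 : w ≠ 0 := by simpa using hind.ne_zero (1, 0)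
  have hh0 : h ≠ 0 := by simpa using hind.ne_zero (0, 1)
  have h7 : y * -y⁻¹ = -1 := by rw [mul_neg, mul_inv_cancel₀ hy]
  have h8 : -y⁻¹ * y = -1 := by rw [neg_mul, inv_mul_cancel₀ hy]
  have h5 : Λ * x⁻¹ * x = - -y⁻¹ - q⁻¹ • y := by
    rw [inv_mul_cancel_right₀ hx, hΛ, neg_neg]
  have hφφy : φ (-y⁻¹) = y := by rw [map_neg, map_inv₀, hφy, inv_neg, neg_neg, inv_inv]
  have h2 : Λ * x⁻¹ * -y⁻¹ = q • (-y⁻¹ * (Λ * x⁻¹)) := by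
    rw [← hφx', ← hφy, ← map_mul, h1, map_smul, map_mul]
  have h6 : x * (Λ * x⁻¹) = -(q⁻¹ • -y⁻¹) - y := by
    have := congrArg φ h5
    rw [map_mul, hφφx, hφx', map_sub, map_neg, map_smul, hφφy, hφy] at this
    rw [this]
    abel
  have hfrac : ∀ d : D, ∃ s ∈ Algebra.adjoin k {x, y}, ∃ t ∈ Algebra.adjoin k {x, y},
      t ≠ 0 ∧ t * d = s := by
    intro d
    obtain ⟨s, t, hs, ht, ht0, rfl⟩ := hD.exists_frac d
    exact ⟨s, hs, t, ht, ht0, mul_inv_cancel_left₀ ht0 _⟩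
  have hfix : ∀ r, φ r = r ↔ MemDivisionClosure k ({h, g} : Set D) r :=
    fixed_iff_memDivisionClosure hq (φ : D →ₐ[k] D) hfrac hφx' hφφx hφy hφφy h1 h2 h5 h6 h7 h8
      (by rwa [hby]) (by rwa [hby]) (by rwa [hby]) hw0
  have hG : ∀ r, (∀ ψ ∈ G, ψ r = r) ↔ φ r = r := by
    intro r
    refine ⟨fun hr => hr φ (Subgroup.subset_closure rfl), fun hr => ?_⟩
    have : G ≤ MulAction.stabilizer (D ≃ₐ[k] D) r :=
      (Subgroup.closure_le _).2 (by rintro _ rfl; exact hr)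
    exact fun ψ hψ => this hψ
  have hset : {r : D | ∀ ψ ∈ G, ψ r = r} = {r : D | MemDivisionClosure k ({h, g} : Set D) r} :=
    Set.ext fun r => (hG r).trans (hfix r)
  have hrel : h * w = q • (w * h) := by
    have hhg : h * g = q • (g * h) + (1 - q) • (1 : D) :=
      mul_eq_smul_mul_add hq h1 h2 h5 h6 h7 h8 (by rwa [hby]) (by rwa [hby]) (by rwa [hby])
    rw [hwdef, mul_sub, ← mul_assoc, hhg]
    simp only [sub_mul, add_mul, smul_mul_assoc, one_mul, mul_one]
    module
  obtain ⟨F, hFx, hFy⟩ := hD.exists_algHom hrel hind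
  refine ⟨hset, F, F.toRingHom.injective, ?_⟩
  rw [hset]
  ext r
  constructor
  · rintro ⟨d, rfl⟩
    have hadj : ∀ s ∈ Algebra.adjoin k {x, y}, F s ∈ divisionClosure k ({h, g} : Set D) := by
      have hhR : h ∈ divisionClosure k ({h, g} : Set D) := MemDivisionClosure.mem (by simp)
      have hgR : g ∈ divisionClosure k ({h, g} : Set D) := MemDivisionClosure.mem (by simp)
      intro s hs
      induction hs using Algebra.adjoin_induction with
      | mem s hs =>
        rcases hs with rfl | rfl
        · rwa [hFx]
        · rw [hFy]
          exact sub_mem (one_mem _) (mul_mem hgR hhR)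
      | algebraMap c => rw [AlgHom.commutes]; exact MemDivisionClosure.scalar c
      | add _ _ _ _ h₁ h₂ => rw [map_add]; exact add_mem h₁ h₂
      | mul _ _ _ _ h₁ h₂ => rw [map_mul]; exact mul_mem h₁ h₂
    obtain ⟨s, t, hs, ht, ht0, rfl⟩ := hD.exists_frac d
    rw [map_mul, map_inv₀]
    exact mul_mem (inv_mem (hadj t ht)) (hadj s hs)
  · intro hr
    induction hr with
    | mem hd =>
      rcases hd with rfl | rfl
      · exact ⟨x, hFx⟩
      · refine ⟨(1 - y) * x⁻¹, ?_⟩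
        rw [map_mul, map_sub, map_one, map_inv₀, hFx, hFy, hwdef, sub_sub_cancel,
          mul_inv_cancel_right₀ hh0]
    | scalar c => exact ⟨_, F.commutes c⟩
    | add _ _ h₁ h₂ => exact F.range.add_mem h₁ h₂
    | neg _ h => exact F.range.neg_mem h
    | mul _ _ h₁ h₂ => exact F.range.mul_mem h₁ h₂
    | inv _ h =>
      obtain ⟨d, rfl⟩ := h
      exact ⟨d⁻¹, map_inv₀ F d⟩
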